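/- arXiv:2504.07534 — 2 statements merged into one kernel-verified Lean document; each statement's English description precedes it below -/
import Mathlib

section
/- Let n ≥ 2, let λ : Fin n → ℝ with λ_i > 0 for all i, let k be an integer with 1 ≤ k ≤ n−1, and suppose e_k(λ) = C(n,k). Then e_{k+1}(λ) ≤ C(n,k+1), with equality if and only if λ_i = 1 for all i. -/
/-- The `k`-th elementary symmetric polynomial of `λ₁,…,λₙ`. -/
noncomputable def esymm {n : ℕ} (l : Fin n → ℝ) (k : ℕ) : ℝ :=
  ∑ S ∈ (Finset.univ : Finset (Fin n)).powersetCard k, ∏ i ∈ S, l i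

/-- The `k`-th elementary symmetric polynomial of the `n−1` values `(λ_j)_{j ≠ i}`. -/
noncomputable def esymmErase {n : ℕ} (l : Fin n → ℝ) (i : Fin n) (k : ℕ) : ℝ :=
  ∑ S ∈ ((Finset.univ : Finset (Fin n)).erase i).powersetCard k, ∏ j ∈ S, l j

open Finset

/-- The mean of the products `∏ i ∈ T, f i` over the `k`-element subsets `T` of `s`
(zero if there are none). -/
noncomputable def esymmMean {ι : Type*} (f : ι → ℝ) (s : Finset ι) (k : ℕ) : ℝ :=
  (∑ T ∈ s.powersetCard k, ∏ i ∈ T, f i) / (s.card.choose k : ℝ)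

section esymmMean

variable {ι : Type*} {f : ι → ℝ}

lemma esymmMean_zero (s : Finset ι) : esymmMean f s 0 = 1 := by
  simp [esymmMean]

lemma esymmMean_of_card_lt {s : Finset ι} {k : ℕ} (h : s.card < k) : esymmMean f s k = 0 := by
  simp [esymmMean, Nat.choose_eq_zero_of_lt h]

lemma esymmMean_pos {s : Finset ι} (hf : ∀ i ∈ s, 0 < f i) {k : ℕ} (hk : k ≤ s.card) :
    0 < esymmMean f s k := by
  refine div_pos (sum_pos (fun T hT => prod_pos fun i hi => hf i ?_) ?_) ?_
  · exact (mem_powersetCard.1 hT).1 hi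
  · exact powersetCard_nonempty.2 hk
  · exact_mod_cast Nat.choose_pos hk

lemma esymmMean_nonneg {s : Finset ι} (hf : ∀ i ∈ s, 0 < f i) (k : ℕ) :
    0 ≤ esymmMean f s k := by
  rcases le_or_gt k s.card with h | h
  · exact (esymmMean_pos hf h).le
  · exact (esymmMean_of_card_lt h).ge

lemma esymmMean_of_forall_eq {s : Finset ι} {c : ℝ} (h : ∀ i ∈ s, f i = c) {k : ℕ}
    (hk : k ≤ s.card) : esymmMean f s k = c ^ k := by
  have hE : ∑ T ∈ s.powersetCard k, ∏ i ∈ T, f i = s.card.choose k * c ^ k := by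
    rw [← card_powersetCard, ← nsmul_eq_mul]
    refine sum_eq_card_nsmul fun T hT => ?_
    obtain ⟨hTs, rfl⟩ := mem_powersetCard.1 hT
    exact prod_eq_pow_card fun i hi => h i (hTs hi)
  have : (s.card.choose k : ℝ) ≠ 0 := by exact_mod_cast (Nat.choose_pos hk).ne'
  rw [esymmMean, hE, mul_div_cancel_left₀ _ this]

lemma esymmMean_mul_choose (s : Finset ι) (k : ℕ) :
    esymmMean f s k * s.card.choose k = ∑ T ∈ s.powersetCard k, ∏ i ∈ T, f i := by
  rcases le_or_gt k s.card with h | h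
  · have : (s.card.choose k : ℝ) ≠ 0 := by exact_mod_cast (Nat.choose_pos h).ne'
    rw [esymmMean, div_mul_cancel₀ _ this]
  · simp [esymmMean, Nat.choose_eq_zero_of_lt h, powersetCard_eq_empty.2 h]

lemma esymmMean_insert_succ [DecidableEq ι] {s : Finset ι} {a : ι} (ha : a ∉ s) (k : ℕ) :
    (s.card + 1) * esymmMean f (insert a s) (k + 1) =
      (s.card - k) * esymmMean f s (k + 1) + (k + 1) * f a * esymmMean f s k := by
  rcases lt_or_ge s.card k with h | h
  · rw [esymmMean_of_card_lt h, esymmMean_of_card_lt (h.trans k.lt_succ_self),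
      esymmMean_of_card_lt (by rw [card_insert_of_notMem ha]; omega)]
    simp
  have hsum : ∑ T ∈ (insert a s).powersetCard (k + 1), ∏ i ∈ T, f i =
      ∑ T ∈ s.powersetCard (k + 1), ∏ i ∈ T, f i + f a * ∑ T ∈ s.powersetCard k, ∏ i ∈ T, f i := by
    have hnot : ∀ T ∈ s.powersetCard k, a ∉ T := fun T hT haT =>
      ha ((mem_powersetCard.1 hT).1 haT)
    rw [powersetCard_succ_insert ha, sum_union, sum_image, mul_sum]
    · congr 1
      exact sum_congr rfl fun T hT => prod_insert (hnot T hT)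
    · intro T hT U hU hTU
      rw [← erase_insert (hnot T hT), hTU, erase_insert (hnot U hU)]
    · refine disjoint_left.2 fun T hT hT' => ?_
      obtain ⟨U, -, rfl⟩ := mem_image.1 hT'
      exact ha ((mem_powersetCard.1 hT).1 (mem_insert_self a U))
  rw [← esymmMean_mul_choose, ← esymmMean_mul_choose, ← esymmMean_mul_choose,
    card_insert_of_notMem ha] at hsum
  have h₁ : ((s.card : ℝ) + 1) * s.card.choose k = (s.card + 1).choose (k + 1) * (k + 1) := by
    exact_mod_cast Nat.add_one_mul_choose_eq s.card k
  have h₂ : (s.card.choose (k + 1) : ℝ) * (k + 1) = s.card.choose k * (s.card - k) := by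
    have := Nat.choose_succ_right_eq s.card k
    rw [← Nat.cast_sub h]
    exact_mod_cast this
  have hpos : (s.card.choose k : ℝ) ≠ 0 := by exact_mod_cast (Nat.choose_pos h).ne'
  apply mul_left_cancel₀ hpos
  linear_combination (k + 1 : ℝ) * hsum + esymmMean f (insert a s) (k + 1) * h₁ +
    esymmMean f s (k + 1) * h₂

/-- The algebraic core of the induction step in Newton's inequality. -/
lemma newton_step {a b c d x r t : ℝ} (hx : 0 ≤ x) (hb : 0 < b) (hc : 0 < c)
    (hr : 1 ≤ r) (ht : 1 ≤ t) (hac : a * c ≤ b ^ 2) (hbd : b * d ≤ c ^ 2)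
    (hd : 0 ≤ d) :
    ((r + 1) * b + (t - 1) * x * a) * ((r - 1) * d + (t + 1) * x * c) + (c - x * b) ^ 2 ≤
      (r * c + t * x * b) ^ 2 := by
  have had : a * d ≤ b * c := by
    have hbc := mul_pos hb hc
    have : (a * c) * (b * d) ≤ b ^ 2 * c ^ 2 :=
      mul_le_mul hac hbd (mul_nonneg hb.le hd) (sq_nonneg b)
    refine le_of_mul_le_mul_right ?_ hbc
    linarith
  have h₁ : 0 ≤ (r - 1) * (r + 1) * (c ^ 2 - b * d) :=
    mul_nonneg (mul_nonneg (by linarith) (by linarith)) (by linarith)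
  have h₂ : 0 ≤ (t - 1) * (t + 1) * x ^ 2 * (b ^ 2 - a * c) :=
    mul_nonneg (mul_nonneg (mul_nonneg (by linarith) (by linarith)) (sq_nonneg x)) (by linarith)
  have h₃ : 0 ≤ (t - 1) * (r - 1) * x * (b * c - a * d) :=
    mul_nonneg (mul_nonneg (mul_nonneg (by linarith) (by linarith)) hx) (by linarith)
  linarith

lemma esymmMean_newton_insert [DecidableEq ι] {s : Finset ι} {a : ι} (ha : a ∉ s)
    (hs : ∀ i ∈ s, 0 < f i) (hfa : 0 < f a)
    (ih : ∀ k, esymmMean f s k * esymmMean f s (k + 2) ≤ esymmMean f s (k + 1) ^ 2)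
    {k : ℕ} (hk : k + 1 ≤ s.card) :
    (s.card + 1) ^ 2 * (esymmMean f (insert a s) k * esymmMean f (insert a s) (k + 2)) +
      (esymmMean f s (k + 1) - f a * esymmMean f s k) ^ 2 ≤
      (s.card + 1) ^ 2 * esymmMean f (insert a s) (k + 1) ^ 2 := by
  have hk' : (k : ℝ) + 1 ≤ s.card := by exact_mod_cast hk
  have e₁ := esymmMean_insert_succ (f := f) ha k
  have e₂ := esymmMean_insert_succ (f := f) ha (k + 1)
  obtain ⟨y, hyc, e₀⟩ : ∃ y, y * esymmMean f s (k + 1) ≤ esymmMean f s k ^ 2 ∧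
      (s.card + 1) * esymmMean f (insert a s) k =
        (s.card - k + 1) * esymmMean f s k + k * f a * y := by
    cases k with
    | zero => exact ⟨0, by simp [sq_nonneg], by simp [esymmMean_zero]⟩
    | succ j =>
      refine ⟨esymmMean f s j, ih j, ?_⟩
      rw [esymmMean_insert_succ ha]
      push_cast
      ring
  push_cast at e₂
  have := newton_step (r := s.card - k) (t := k + 1) hfa.le (esymmMean_pos hs (by omega))
    (esymmMean_pos hs hk) (by linarith) (by linarith [Nat.cast_nonneg (α := ℝ) k]) hyc
    (ih k) (esymmMean_nonneg hs _)
  calc _ = ((s.card + 1) * esymmMean f (insert a s) k) *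
        ((s.card + 1) * esymmMean f (insert a s) (k + 2)) +
        (esymmMean f s (k + 1) - f a * esymmMean f s k) ^ 2 := by ring
    _ ≤ ((s.card + 1) * esymmMean f (insert a s) (k + 1)) ^ 2 := by
      rw [e₀, e₁, e₂]
      linarith
    _ = _ := by ring

/-- Newton's inequality. -/
theorem esymmMean_newton {s : Finset ι} (hs : ∀ i ∈ s, 0 < f i) (k : ℕ) :
    esymmMean f s k * esymmMean f s (k + 2) ≤ esymmMean f s (k + 1) ^ 2 := by
  classical
  induction s using Finset.induction_on generalizing k with
  | empty =>
    rw [esymmMean_of_card_lt (k := k + 2) (by simp), mul_zero]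
    positivity
  | insert a s ha ih =>
    rcases le_or_gt (k + 1) s.card with h | h
    · have hs' : ∀ i ∈ s, 0 < f i := fun i hi => hs i (mem_insert_of_mem hi)
      have := esymmMean_newton_insert ha hs' (hs a (mem_insert_self a s)) (ih hs') h
      refine le_of_mul_le_mul_left ?_ (by positivity : (0 : ℝ) < (s.card + 1) ^ 2)
      linarith [sq_nonneg (esymmMean f s (k + 1) - f a * esymmMean f s k)]
    · rw [esymmMean_of_card_lt (k := k + 2) (by rw [card_insert_of_notMem ha]; omega), mul_zero]
      positivity

/-- The equality case of Newton's inequality for the first three means. -/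
lemma eq_esymmMean_one_of_esymmMean_two_eq {s : Finset ι} (hs : ∀ i ∈ s, 0 < f i)
    (hcard : 2 ≤ s.card) (h : esymmMean f s 2 = esymmMean f s 1 ^ 2) {i : ι} (hi : i ∈ s) :
    f i = esymmMean f s 1 := by
  classical
  have hs' : ∀ j ∈ s.erase i, 0 < f j := fun j hj => hs j (mem_of_mem_erase hj)
  have hc := card_erase_of_mem hi
  have hN := esymmMean_newton_insert (notMem_erase i s) hs' (hs i hi) (esymmMean_newton hs')
    (k := 0) (by omega)
  have hR := esymmMean_insert_succ (f := f) (notMem_erase i s) 0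
  simp only [insert_erase hi, esymmMean_zero, zero_add, h, one_mul, mul_one, Nat.cast_zero,
    sub_zero] at hN hR
  have hsq : esymmMean f (s.erase i) 1 = f i :=
    sub_eq_zero.1 (pow_eq_zero_iff two_ne_zero |>.1 (le_antisymm (by linarith) (sq_nonneg _)))
  rw [hsq] at hR
  refine mul_left_cancel₀ (by positivity : ((s.erase i).card : ℝ) + 1 ≠ 0) ?_
  linarith

end esymmMean

/-- Maclaurin's inequality for a positive log-concave sequence starting at `1`, together with its
equality case. -/
lemma pow_le_pow_succ_of_newton {p : ℕ → ℝ} {m : ℕ} (h0 : p 0 = 1) (hp : ∀ k ≤ m, 0 < p k)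
    (hN : ∀ k, p k * p (k + 2) ≤ p (k + 1) ^ 2) {k : ℕ} (hk : k + 2 ≤ m) :
    p (k + 2) ^ (k + 1) ≤ p (k + 1) ^ (k + 2) ∧
      (p (k + 2) ^ (k + 1) = p (k + 1) ^ (k + 2) → p 2 = p 1 ^ 2) := by
  induction k with
  | zero =>
    have := hN 0
    simp only [h0, one_mul, zero_add, pow_one] at this ⊢
    exact ⟨this, id⟩
  | succ k ih =>
    obtain ⟨ih₁, ih₂⟩ := ih (by omega)
    have h₁ := hp (k + 1) (by omega)
    have h₂ := hp (k + 2) (by omega)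
    have h₃ := hp (k + 3) (by omega)
    have key : p (k + 1) ^ (k + 2) * p (k + 3) ^ (k + 2) ≤
        p (k + 2) ^ (k + 1) * p (k + 2) ^ (k + 3) := by
      rw [← mul_pow, ← pow_add]
      calc _ ≤ (p (k + 2) ^ 2) ^ (k + 2) := pow_le_pow_left₀ (by positivity) (hN (k + 1)) _
        _ = _ := by rw [← pow_mul]; congr 1; ring
    refine ⟨?_, fun h => ih₂ (le_antisymm ih₁ ?_)⟩
    · refine le_of_mul_le_mul_left ?_ (pow_pos h₂ (k + 1))
      exact (mul_le_mul_of_nonneg_right ih₁ (pow_nonneg h₃.le _)).trans key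
    · change p (k + 3) ^ (k + 2) = p (k + 2) ^ (k + 3) at h
      rw [h] at key
      exact le_of_mul_le_mul_right key (by positivity)

theorem stmt_12 (n : ℕ) (hn : 2 ≤ n) (l : Fin n → ℝ) (hl : ∀ i, 0 < l i)
    (k : ℕ) (hk1 : 1 ≤ k) (hkn : k ≤ n - 1) (he : esymm l k = (n.choose k : ℝ)) :
    esymm l (k + 1) ≤ (n.choose (k + 1) : ℝ) ∧
      (esymm l (k + 1) = (n.choose (k + 1) : ℝ) ↔ ∀ i, l i = 1) := by
  obtain ⟨j, rfl⟩ : ∃ j, k = j + 1 := ⟨k - 1, by omega⟩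
  have hs : ∀ i ∈ (univ : Finset (Fin n)), 0 < l i := fun i _ => hl i
  have hcard : (univ : Finset (Fin n)).card = n := by simp
  have hmean (m : ℕ) : esymmMean l univ m = esymm l m / n.choose m := by
    rw [esymmMean, hcard, esymm]
  have hchoose {m : ℕ} (hm : m ≤ n) : (0 : ℝ) < n.choose m := by
    exact_mod_cast Nat.choose_pos hm
  have h₁ : esymmMean l univ (j + 1) = 1 := by
    rw [hmean, he, div_self (hchoose (by omega)).ne']
  obtain ⟨hle, heq⟩ := pow_le_pow_succ_of_newton (esymmMean_zero univ)
    (fun m hm => esymmMean_pos hs (hm.trans_eq hcard.symm)) (esymmMean_newton hs)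
    (show j + 2 ≤ n by omega)
  have hpos := hchoose (show j + 2 ≤ n by omega)
  rw [h₁, one_pow] at hle heq
  refine ⟨?_, fun h => ?_, fun h => ?_⟩
  · have := (pow_le_one_iff_of_nonneg (esymmMean_nonneg hs _) j.succ_ne_zero).1 hle
    rwa [hmean, div_le_one hpos] at this
  · have h₂ : esymmMean l univ (j + 2) = 1 := by
      rw [hmean, h, div_self hpos.ne']
    have hall := fun i => eq_esymmMean_one_of_esymmMean_two_eq hs (by omega)
      (heq (by rw [h₂, one_pow])) (mem_univ i)
    have hpow := esymmMean_of_forall_eq (fun i _ => hall i) (show j + 1 ≤ univ.card by omega)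
    rw [h₁] at hpow
    intro i
    rw [hall i]
    exact (pow_eq_one_iff_of_nonneg (esymmMean_nonneg hs 1) j.succ_ne_zero).1 hpow.symm
  · have := esymmMean_of_forall_eq (fun i _ => h i) (show j + 2 ≤ univ.card by omega)
    rwa [hmean, one_pow, div_eq_one_iff_eq hpos.ne'] at this
end

section
/- Let n ≥ 2, let λ : Fin n → ℝ with λ_i > 0 for all i, let k be an integer with 2 ≤ k ≤ n, and suppose e_k(λ) = C(n,k). Then (n − k + 1)·e_{k−1}(λ) − k·e_k(λ) ≥ 0, with equality if and only if λ_i = 1 for all i. -/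
theorem Multiset.esymm_pos {s : Multiset ℝ} (hs : ∀ x ∈ s, 0 < x) {j : ℕ} (hj : j ≤ s.card) :
    0 < s.esymm j := by
  rw [Multiset.esymm]
  refine Multiset.sum_induction_nonempty (fun x : ℝ => 0 < x) (fun a b ha hb => add_pos ha hb) ?_ ?_
  · refine mt Multiset.card_eq_zero.2 ?_
    rw [Multiset.card_map, Multiset.card_powersetCard]
    exact (Nat.choose_pos hj).ne'
  · intro x hx
    obtain ⟨t, ht, rfl⟩ := Multiset.mem_map.1 hx
    exact Multiset.prod_induction (fun x : ℝ => 0 < x) t (fun a b ha hb => mul_pos ha hb) one_pos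
      fun y hy => hs y (Multiset.mem_of_le (Multiset.mem_powersetCard.1 ht).1 hy)

theorem Multiset.esymm_cons_succ {R : Type*} [CommSemiring R] (a : R) (s : Multiset R) (k : ℕ) :
    (a ::ₘ s).esymm (k + 1) = s.esymm (k + 1) + a * s.esymm k := by
  simp [Multiset.esymm, Multiset.powersetCard_cons, Multiset.sum_map_mul_left]

theorem Multiset.esymm_zero_right {R : Type*} [CommSemiring R] (s : Multiset R) :
    s.esymm 0 = 1 := by
  simp [Multiset.esymm]

theorem Multiset.esymm_one_right {R : Type*} [CommSemiring R] (s : Multiset R) :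
    s.esymm 1 = s.sum := by
  simp [Multiset.esymm, Multiset.powersetCard_one]

theorem Multiset.esymm_card {R : Type*} [CommSemiring R] (s : Multiset R) :
    s.esymm s.card = s.prod := by
  simp [Multiset.esymm]

theorem Multiset.esymm_replicate_one {R : Type*} [CommSemiring R] (n k : ℕ) :
    (Multiset.replicate n (1 : R)).esymm k = n.choose k := by
  rw [Multiset.esymm, Multiset.map_congr rfl (g := fun _ => (1 : R))]
  · simp
  · intro t ht
    exact Multiset.prod_eq_one fun x hx => Multiset.eq_of_mem_replicate
      (Multiset.mem_of_le (Multiset.mem_powersetCard.1 ht).1 hx)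

/-- Newton's identity for the sum of squares. -/
theorem Multiset.sum_sq_eq {R : Type*} [CommRing R] (s : Multiset R) :
    s.sum ^ 2 = (s.map (· ^ 2)).sum + 2 * s.esymm 2 := by
  induction s using Multiset.induction with
  | empty => simp [Multiset.esymm, Multiset.powersetCard_zero_right]
  | cons a s ih =>
    rw [Multiset.esymm_cons_succ, Multiset.esymm_one_right, Multiset.sum_cons, Multiset.map_cons,
      Multiset.sum_cons]
    linear_combination ih

theorem Multiset.esymm_card_sub_one {s : Multiset ℝ} (hs : ∀ x ∈ s, 0 < x) (h : s ≠ 0) :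
    s.esymm (s.card - 1) = s.prod * (s.map (·⁻¹)).sum := by
  induction s using Multiset.induction with
  | empty => exact absurd rfl h
  | cons a s ih =>
    have ha : a ≠ 0 := (hs a (Multiset.mem_cons_self a s)).ne'
    rcases eq_or_ne s 0 with rfl | hs0
    · simp [Multiset.esymm, ha]
    · obtain ⟨m, hm⟩ := Nat.exists_eq_succ_of_ne_zero (mt Multiset.card_eq_zero.1 hs0)
      have ih' := ih (fun x hx => hs x (Multiset.mem_cons_of_mem hx)) hs0
      have hp := s.esymm_card
      simp only [hm, Nat.succ_eq_add_one, Nat.add_sub_cancel] at ih' hp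
      rw [Multiset.card_cons, hm, Nat.add_sub_cancel, Nat.succ_eq_add_one,
        Multiset.esymm_cons_succ, ih', hp, Multiset.prod_cons, Multiset.map_cons,
        Multiset.sum_cons]
      field_simp

/-- The sum of the inverses of positive reals with product one is at least their number. -/
theorem Multiset.card_le_sum_inv_of_prod_eq_one {s : Multiset ℝ} (hs : ∀ x ∈ s, 0 < x)
    (hp : s.prod = 1) :
    (s.card : ℝ) ≤ (s.map (·⁻¹)).sum ∧ ((s.map (·⁻¹)).sum = s.card → ∀ x ∈ s, x = 1) := by
  have key : ∀ s : Multiset ℝ, (∀ x ∈ s, 0 < x) →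
      s.card - Real.log s.prod ≤ (s.map (·⁻¹)).sum ∧
        ((s.map (·⁻¹)).sum = s.card - Real.log s.prod → ∀ x ∈ s, x = 1) := by
    intro s
    induction s using Multiset.induction with
    | empty => simp
    | cons a s ih =>
      intro hs
      have ha : 0 < a := hs a (Multiset.mem_cons_self a s)
      have hs' : ∀ x ∈ s, 0 < x := fun x hx => hs x (Multiset.mem_cons_of_mem hx)
      obtain ⟨h1, h2⟩ := ih hs'
      have hpos : 0 < s.prod := Multiset.esymm_card s ▸ Multiset.esymm_pos hs' le_rfl
      have hlog := Real.log_le_sub_one_of_pos (inv_pos.2 ha)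
      rw [Real.log_inv] at hlog
      rw [Multiset.map_cons, Multiset.sum_cons, Multiset.prod_cons, Multiset.card_cons,
        Real.log_mul ha.ne' hpos.ne']
      push_cast
      refine ⟨by linarith, fun heq x hx => ?_⟩
      rcases Multiset.mem_cons.1 hx with rfl | hx
      · by_contra hne
        have hlt := Real.log_lt_sub_one_of_pos (inv_pos.2 ha) (by simpa using hne)
        rw [Real.log_inv] at hlt
        linarith
      · exact h2 (by linarith) x hx
  simpa [hp] using key s hs

open Polynomial in
/-- By Rolle's theorem, the derivative of `∏ (X + x)` over positive reals `x` splits again as a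
multiple of such a product, with the same normalized elementary symmetric functions. -/
theorem Multiset.exists_esymm_eq_of_pos {n : ℕ} {s : Multiset ℝ} (hs : ∀ x ∈ s, 0 < x)
    (hn : s.card = n + 1) :
    ∃ t : Multiset ℝ, t.card = n ∧ (∀ x ∈ t, 0 < x) ∧
      ∀ j ≤ n, (n + 1 : ℝ) * t.esymm j = (n + 1 - j) * s.esymm j := by
  set P : ℝ[X] := (s.map fun r => X + C r).prod with hP
  have hcoeff : ∀ j ≤ n, (derivative P).coeff (n - j) = (n + 1 - j) * s.esymm j := by
    intro j hj
    rw [coeff_derivative, hP, Multiset.prod_X_add_C_coeff s (by omega), hn,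
      show n + 1 - (n - j + 1) = j by omega, Nat.cast_sub hj]
    ring
  have hPneg : P = ((s.map Neg.neg).map fun r => X - C r).prod := by
    rw [hP, Multiset.map_map]
    simp
  have hPdeg : P.natDegree = n + 1 := by
    rw [hPneg, natDegree_multiset_prod_X_sub_C_eq_card, Multiset.card_map, hn]
  have hdeg : (derivative P).natDegree = n := by
    rw [natDegree_derivative, hPdeg, Nat.add_sub_cancel]
  have hlead : (derivative P).leadingCoeff = n + 1 := by
    rw [leadingCoeff, hdeg]
    simpa [Multiset.esymm_zero_right] using hcoeff 0 (Nat.zero_le n)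
  have hroots : P.roots.card = n + 1 := by
    rw [hPneg, roots_multiset_prod_X_sub_C, Multiset.card_map, hn]
  have hcard : (derivative P).roots.card = (derivative P).natDegree := by
    have h1 := P.card_roots_le_derivative
    have h2 := (derivative P).card_roots'
    omega
  have hfac : derivative P = C ((n : ℝ) + 1) *
      (((derivative P).roots.map Neg.neg).map fun r => X + C r).prod := by
    conv_lhs => rw [← C_leadingCoeff_mul_prod_multiset_X_sub_C hcard]
    rw [hlead, Multiset.map_map]
    simp [sub_eq_add_neg]
  have htcard : ((derivative P).roots.map Neg.neg).card = n := by
    rw [Multiset.card_map, hcard, hdeg]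
  refine ⟨(derivative P).roots.map Neg.neg, htcard, ?_, ?_⟩
  · intro x hx
    obtain ⟨y, hy, rfl⟩ := Multiset.mem_map.1 hx
    have hroot : (derivative P).eval y = 0 := (mem_roots'.1 hy).2
    by_contra hneg
    have hy0 : 0 ≤ y := by linarith
    have hc : ∀ i ≤ n, 0 < (derivative P).coeff i := by
      intro i hi
      rw [← Nat.sub_sub_self hi, hcoeff _ (Nat.sub_le n i)]
      refine mul_pos ?_ (Multiset.esymm_pos hs (by omega))
      rw [Nat.cast_sub hi]
      linarith [(Nat.cast_nonneg i : (0 : ℝ) ≤ i)]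
    rw [eval_eq_sum_range, hdeg] at hroot
    have hz := (Finset.sum_eq_zero_iff_of_nonneg fun i hi =>
      mul_nonneg (hc i (Finset.mem_range_succ_iff.1 hi)).le (pow_nonneg hy0 i)).1 hroot 0 (by simp)
    rw [pow_zero, mul_one] at hz
    exact (hc 0 (Nat.zero_le n)).ne' hz
  · intro j hj
    have h := congrArg (fun p => p.coeff (n - j)) hfac
    simp only [coeff_C_mul] at h
    rw [Multiset.prod_X_add_C_coeff _ (by omega), htcard, Nat.sub_sub_self hj, hcoeff j hj] at h
    exact h.symm

/-- Maclaurin's inequality for consecutive normalized elementary symmetric functions, under the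
normalization that the one of larger degree is one. -/
theorem Multiset.choose_le_esymm_of_esymm_succ_eq_choose {k n : ℕ} (hk : 1 ≤ k) (hkn : k + 1 ≤ n)
    {s : Multiset ℝ} (hs : ∀ x ∈ s, 0 < x) (hn : s.card = n)
    (he : s.esymm (k + 1) = n.choose (k + 1)) :
    (n.choose k : ℝ) ≤ s.esymm k ∧ (s.esymm k = n.choose k → ∀ x ∈ s, x = 1) := by
  induction n, hkn using Nat.le_induction generalizing s with
  | base =>
    rw [← hn, Multiset.esymm_card, hn, Nat.choose_self, Nat.cast_one] at he
    have hs0 : s ≠ 0 := by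
      rintro rfl
      simp at hn
    have hinv := Multiset.esymm_card_sub_one hs hs0
    rw [hn, Nat.add_sub_cancel, he, one_mul] at hinv
    rw [hinv, Nat.choose_succ_self_right, ← hn]
    exact Multiset.card_le_sum_inv_of_prod_eq_one hs he
  | succ n hkn ih =>
    obtain ⟨t, ht, htpos, hte⟩ := Multiset.exists_esymm_eq_of_pos hs hn
    have hchoose : ∀ j ≤ n, ((n : ℝ) + 1) * n.choose j = (n + 1 - j) * (n + 1).choose j := by
      intro j hj
      have h := congrArg (Nat.cast (R := ℝ)) (Nat.choose_mul_succ_eq n j)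
      rw [Nat.cast_mul, Nat.cast_mul, Nat.cast_sub (by omega)] at h
      push_cast at h
      linarith
    have hn1 : (0 : ℝ) < n + 1 := by positivity
    have hpos : ∀ j ≤ n, (0 : ℝ) < n + 1 - j := by
      intro j hj
      have : (j : ℝ) ≤ n := by exact_mod_cast hj
      linarith
    have het : t.esymm (k + 1) = n.choose (k + 1) := by
      apply mul_left_cancel₀ hn1.ne'
      rw [hte _ hkn, hchoose _ hkn, he]
    obtain ⟨h1, h2⟩ := ih htpos ht het
    have hk' : k ≤ n := by omega
    constructor
    · refine le_of_mul_le_mul_left ?_ (hpos k hk')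
      rw [← hte k hk', ← hchoose k hk']
      exact mul_le_mul_of_nonneg_left h1 hn1.le
    · intro heq
      have htk : t.esymm k = n.choose k := by
        apply mul_left_cancel₀ hn1.ne'
        rw [hte _ hk', hchoose _ hk', heq]
      have ht1 : t = Multiset.replicate n 1 := Multiset.eq_replicate.2 ⟨ht, h2 htk⟩
      have hse : ∀ j ≤ n, s.esymm j = (n + 1).choose j := by
        intro j hj
        apply mul_left_cancel₀ (hpos j hj).ne'
        rw [← hte j hj, ← hchoose j hj, ht1, Multiset.esymm_replicate_one]
      have hsum : s.sum = n + 1 := by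
        rw [← Multiset.esymm_one_right, hse 1 (by omega), Nat.choose_one_right]
        push_cast
        rfl
      have hsq := s.sum_sq_eq
      rw [hse 2 (by omega), Nat.cast_choose_two, hsum] at hsq
      push_cast at hsq
      have hvar : (s.map fun x => (x - 1) ^ 2).sum = 0 := by
        have : (s.map fun x => (x - 1) ^ 2).sum = (s.map (· ^ 2)).sum - 2 * s.sum + s.card := by
          clear * -
          induction s using Multiset.induction with
          | empty => simp
          | cons a s ih =>
            simp only [Multiset.map_cons, Multiset.sum_cons, Multiset.card_cons, ih]
            push_cast
            ring
        rw [this, hsum, hn]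
        push_cast
        linarith
      intro x hx
      have hle := Multiset.single_le_sum (s := s.map fun x => (x - 1) ^ 2)
        (fun y hy => by
          obtain ⟨z, -, rfl⟩ := Multiset.mem_map.1 hy
          exact sq_nonneg _) _ (Multiset.mem_map_of_mem _ hx)
      rw [hvar] at hle
      exact sub_eq_zero.1 (pow_eq_zero_iff two_ne_zero |>.1 (le_antisymm hle (sq_nonneg _)))

theorem esymm_eq_multiset_esymm {n : ℕ} (l : Fin n → ℝ) (k : ℕ) :
    esymm l k = ((Finset.univ : Finset (Fin n)).val.map l).esymm k :=
  (Finset.esymm_map_val l Finset.univ k).symm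

theorem stmt_15 (n : ℕ) (hn : 2 ≤ n) (l : Fin n → ℝ) (hl : ∀ i, 0 < l i)
    (k : ℕ) (hk2 : 2 ≤ k) (hkn : k ≤ n) (he : esymm l k = (n.choose k : ℝ)) :
    0 ≤ ((n : ℝ) - k + 1) * esymm l (k - 1) - k * esymm l k ∧
      (((n : ℝ) - k + 1) * esymm l (k - 1) - k * esymm l k = 0 ↔ ∀ i, l i = 1) := by
  obtain ⟨k, rfl⟩ : ∃ m, k = m + 1 := ⟨k - 1, by omega⟩
  have hs : ∀ x ∈ (Finset.univ : Finset (Fin n)).val.map l, 0 < x := by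
    intro x hx
    obtain ⟨i, -, rfl⟩ := Multiset.mem_map.1 hx
    exact hl i
  have hmac := Multiset.choose_le_esymm_of_esymm_succ_eq_choose (k := k) (n := n) (by omega) hkn hs
    (by simp) (by rw [← esymm_eq_multiset_esymm, he])
  rw [← esymm_eq_multiset_esymm] at hmac
  obtain ⟨hle, heq⟩ := hmac
  have hchoose : ((k + 1 : ℕ) : ℝ) * n.choose (k + 1) = (n - k) * n.choose k := by
    have h := congrArg (Nat.cast (R := ℝ)) (Nat.choose_succ_right_eq n k)
    rw [Nat.cast_mul, Nat.cast_mul, Nat.cast_sub (by omega)] at h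
    linarith
  have hpos : (0 : ℝ) < n - k := by
    have : ((k + 1 : ℕ) : ℝ) ≤ n := by exact_mod_cast hkn
    push_cast at this
    linarith
  have hrw : ((n : ℝ) - (k + 1 : ℕ) + 1) * esymm l (k + 1 - 1) - (k + 1 : ℕ) * esymm l (k + 1) =
      (n - k) * (esymm l k - n.choose k) := by
    rw [he, hchoose, Nat.add_sub_cancel]
    push_cast
    ring
  rw [hrw]
  refine ⟨mul_nonneg hpos.le (sub_nonneg.2 hle), fun h i => ?_, fun h => ?_⟩
  · have hk := sub_eq_zero.1 ((mul_eq_zero.1 h).resolve_left hpos.ne')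
    exact heq hk _ (Multiset.mem_map_of_mem l (Finset.mem_univ_val i))
  · simp [esymm, h]
end
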